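/- Let ε = e^{2πi/5}, u_5(x,y) = x^8 + x^7y + 7x^6y^2 − 7x^5y^3 + 7x^3y^5 + 7x^2y^6 − xy^7 + y^8, and for k = 1,…,5 set u_k(x,y) = u_5(ε^{3k}x, ε^{2k}y). Let F(x,y) = x·y·(x^10 − 11x^5y^5 − y^10) and H(x,y) = x^20 + 228x^15y^5 + 494x^10y^10 − 228x^5y^15 + y^20. Then the fourth elementary symmetric function ∑_{k=1}^{5} (u_1·u_2·u_3·u_4·u_5)/u_k (i.e., the sum over k of the products of the four u_j with j ≠ k) equals −5·F·H in ℂ[x,y]. -/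

import Mathlib

open MvPolynomial

noncomputable def ε : ℂ := Complex.exp (2 * Real.pi * Complex.I / 5)

noncomputable def u5 : MvPolynomial (Fin 2) ℂ :=
  (X 0) ^ 8 + (X 0) ^ 7 * X 1 + 7 * (X 0) ^ 6 * (X 1) ^ 2 - 7 * (X 0) ^ 5 * (X 1) ^ 3
    + 7 * (X 0) ^ 3 * (X 1) ^ 5 + 7 * (X 0) ^ 2 * (X 1) ^ 6 - X 0 * (X 1) ^ 7 + (X 1) ^ 8

/-- `u k` is `u5(ε^(3k) x, ε^(2k) y)`. -/
noncomputable def u (k : ℕ) : MvPolynomial (Fin 2) ℂ :=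
  aeval ![C (ε ^ (3 * k)) * X 0, C (ε ^ (2 * k)) * X 1] u5

noncomputable def F : MvPolynomial (Fin 2) ℂ :=
  X 0 * X 1 * ((X 0) ^ 10 - 11 * (X 0) ^ 5 * (X 1) ^ 5 - (X 1) ^ 10)

noncomputable def H : MvPolynomial (Fin 2) ℂ :=
  (X 0) ^ 20 + 228 * (X 0) ^ 15 * (X 1) ^ 5 + 494 * (X 0) ^ 10 * (X 1) ^ 10
    - 228 * (X 0) ^ 5 * (X 1) ^ 15 + (X 1) ^ 20

/-- The fourth elementary symmetric function of the five values at the fifth roots of unity of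
`a t + b t² + c t³ + d t⁴`. -/
theorem esymm4_of_geom_sum_eq_zero {R : Type*} [CommRing R] {z : R}
    (hz : 1 + z + z ^ 2 + z ^ 3 + z ^ 4 = 0) (a b c d : R) {v₁ v₂ v₃ v₄ v₅ : R}
    (h₁ : v₁ = a * z + b * z ^ 2 + c * z ^ 3 + d * z ^ 4)
    (h₂ : v₂ = a * z ^ 2 + b * z ^ 4 + c * z + d * z ^ 3)
    (h₃ : v₃ = a * z ^ 3 + b * z + c * z ^ 4 + d * z ^ 2)
    (h₄ : v₄ = a * z ^ 4 + b * z ^ 3 + c * z ^ 2 + d * z)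
    (h₅ : v₅ = a + b + c + d) {S M N : R} (hS : S = a ^ 2 + b ^ 2 + c ^ 2 + d ^ 2)
    (hM : M = a * b + b * c + c * d) (hN : N = a * c + b * d + a * d) :
    v₂ * v₃ * v₄ * v₅ + v₁ * v₃ * v₄ * v₅ + v₁ * v₂ * v₄ * v₅ + v₁ * v₂ * v₃ * v₅
        + v₁ * v₂ * v₃ * v₄ =
      S ^ 2 - S * (M + N) - M ^ 2 - N ^ 2 + 3 * M * N
        + (a + b + c + d) * ((a + d) * (3 * N - 2 * M - S) + (b + c) * (3 * M - 2 * N - S)) := by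
  have hz5 : z ^ 5 = 1 := by linear_combination (z - 1) * hz
  obtain ⟨α, hα⟩ : ∃ α, α = z + z ^ 4 := ⟨_, rfl⟩
  obtain ⟨β, hβ⟩ : ∃ β, β = z ^ 2 + z ^ 3 := ⟨_, rfl⟩
  have hadd : α + β = -1 := by rw [hα, hβ]; linear_combination hz
  have hmul : α * β = -1 := by rw [hα, hβ]; linear_combination hz + (z + z ^ 2) * hz5
  have h14 : v₁ * v₄ = S + α * M + β * N := by
    rw [h₁, h₄, hα, hβ, hS, hM, hN]
    clear * - hz5
    grind
  have h23 : v₂ * v₃ = S + β * M + α * N := by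
    rw [h₂, h₃, hα, hβ, hS, hM, hN]
    clear * - hz5
    grind
  have s14 : v₁ + v₄ = α * (a + d) + β * (b + c) := by rw [h₁, h₄, hα, hβ]; ring
  have s23 : v₂ + v₃ = β * (a + d) + α * (b + c) := by rw [h₂, h₃, hα, hβ]; ring
  calc
    _ = (v₁ * v₄) * (v₂ * v₃) + v₅ * ((v₂ * v₃) * (v₁ + v₄) + (v₁ * v₄) * (v₂ + v₃)) := by ring
    _ = _ := by
      rw [h14, h23, s14, s23, h₅]
      obtain rfl : β = -1 - α := by linear_combination hadd
      have hsq : α ^ 2 = 1 - α := by linear_combination -hmul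
      clear * - hsq
      grind

theorem ε_geom_sum : 1 + ε + ε ^ 2 + ε ^ 3 + ε ^ 4 = 0 := by
  have h : IsPrimitiveRoot ε 5 := by
    simpa [ε] using Complex.isPrimitiveRoot_exp 5 (by norm_num)
  simpa [Finset.sum_range_succ] using h.geom_sum_eq_zero (by norm_num)

theorem u_eq (k : ℕ) :
    u k = ((X 1) ^ 8 - 7 * (X 0) ^ 5 * (X 1) ^ 3) * C ε ^ k
      + (7 * (X 0) ^ 6 * (X 1) ^ 2 - X 0 * (X 1) ^ 7) * C ε ^ (2 * k)
      + ((X 0) ^ 7 * X 1 + 7 * (X 0) ^ 2 * (X 1) ^ 6) * C ε ^ (3 * k)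
      + ((X 0) ^ 8 + 7 * (X 0) ^ 3 * (X 1) ^ 5) * C ε ^ (4 * k) := by
  have h5 : (C ε : MvPolynomial (Fin 2) ℂ) ^ 5 = 1 := by
    rw [← C_pow, ← C_1]
    congr 1
    linear_combination (ε - 1) * ε_geom_sum
  have hk : ((C ε : MvPolynomial (Fin 2) ℂ) ^ k) ^ 5 = 1 := by rw [pow_right_comm, h5, one_pow]
  simp only [u, u5, map_add, map_sub, map_mul, map_pow, aeval_X, map_ofNat,
    Matrix.cons_val_zero, Matrix.cons_val_one, mul_comm _ k, pow_mul]
  generalize (C ε : MvPolynomial (Fin 2) ℂ) ^ k = w at hk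
  grind

theorem esymm4_u_eq_neg5_FH :
    ∑ k ∈ Finset.Icc 1 5, ∏ j ∈ (Finset.Icc 1 5).erase k, u j = -5 * F * H := by
  have hz : 1 + C ε + C ε ^ 2 + C ε ^ 3 + C ε ^ 4 = (0 : MvPolynomial (Fin 2) ℂ) := by
    simpa using congrArg (C (σ := Fin 2)) ε_geom_sum
  have hz5 : (C ε : MvPolynomial (Fin 2) ℂ) ^ 5 = 1 := by linear_combination (C ε - 1) * hz
  have hmod (n : ℕ) : (C ε : MvPolynomial (Fin 2) ℂ) ^ n = C ε ^ (n % 5) := pow_eq_pow_mod n hz5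
  have hsum : ∑ k ∈ Finset.Icc 1 5, ∏ j ∈ (Finset.Icc 1 5).erase k, u j =
      u 2 * u 3 * u 4 * u 5 + u 1 * u 3 * u 4 * u 5 + u 1 * u 2 * u 4 * u 5
        + u 1 * u 2 * u 3 * u 5 + u 1 * u 2 * u 3 * u 4 := by
    have h : Finset.Icc 1 5 = ({1, 2, 3, 4, 5} : Finset ℕ) := by decide
    have e₁ : (Finset.Icc 1 5).erase 1 = ({2, 3, 4, 5} : Finset ℕ) := by decide
    have e₂ : (Finset.Icc 1 5).erase 2 = ({1, 3, 4, 5} : Finset ℕ) := by decide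
    have e₃ : (Finset.Icc 1 5).erase 3 = ({1, 2, 4, 5} : Finset ℕ) := by decide
    have e₄ : (Finset.Icc 1 5).erase 4 = ({1, 2, 3, 5} : Finset ℕ) := by decide
    have e₅ : (Finset.Icc 1 5).erase 5 = ({1, 2, 3, 4} : Finset ℕ) := by decide
    rw [Finset.sum_congr h fun _ _ => rfl]
    simp [e₁, e₂, e₃, e₄, e₅, mul_assoc, add_assoc]
  rw [hsum, esymm4_of_geom_sum_eq_zero hz
    ((X 1) ^ 8 - 7 * (X 0) ^ 5 * (X 1) ^ 3) (7 * (X 0) ^ 6 * (X 1) ^ 2 - X 0 * (X 1) ^ 7)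
    ((X 0) ^ 7 * X 1 + 7 * (X 0) ^ 2 * (X 1) ^ 6) ((X 0) ^ 8 + 7 * (X 0) ^ 3 * (X 1) ^ 5)
    (by rw [u_eq]; norm_num) (by rw [u_eq, hmod (3 * 2), hmod (4 * 2)]; norm_num)
    (by rw [u_eq, hmod (2 * 3), hmod (3 * 3), hmod (4 * 3)]; norm_num)
    (by rw [u_eq, hmod (2 * 4), hmod (3 * 4), hmod (4 * 4)]; norm_num)
    (by rw [u_eq, hmod 5, hmod (2 * 5), hmod (3 * 5), hmod (4 * 5)]; norm_num) rfl rfl rfl, F, H]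
  ring
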